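/- Let V = (Q, Σ, Δ) be a d-TVASS and let L be a linear path scheme that is bounded from a configuration p(x⃗). Then every configuration q(y⃗) with p(x⃗) →^L q(y⃗) satisfies ‖y⃗‖ ≤ (‖x⃗‖ + |L|·‖Σ‖)·(1 + |L|·‖Σ‖)^{|L|_*}. -/

import Mathlib

namespace TVASSpaper

/-- Actions of a `d`-TVASS: `some a` is an addition of the vector `a ∈ ℤ^d`,
    `none` is the zero-test action `tst` (on the first counter). -/
abbrev Act (d : ℕ) := Option (Fin d → ℤ)

/-- Transitions. -/
abbrev Trans (d : ℕ) (Q : Type) := Q × Act d × Q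

/-- Configurations: a state together with a vector of `d` counters. -/
abbrev Config (d : ℕ) (Q : Type) := Q × (Fin d → ℕ)

/-- A `d`-TVASS: a finite set `acts` of actions and a finite set of transitions
    `trans ⊆ Q × acts × Q`. The state set `Q` is a (finite, nonempty) type. -/
structure TVASS (d : ℕ) (Q : Type) where
  acts : Finset (Act d)
  trans : Finset (Trans d Q)
  mem_acts : ∀ t ∈ trans, t.2.1 ∈ acts

variable {d : ℕ} {Q : Type}

/-- The step induced by a single transition: an addition transition `(p, a, q)`
    induces `p(x) → q(x + a)` whenever `x + a ∈ ℕ^d`; a zero-test transition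
    `(p, tst, q)` induces `p(x) → q(x)` whenever the first counter is `0`. -/
def StepBy [NeZero d] (t : Trans d Q) (c c' : Config d Q) : Prop :=
  t.1 = c.1 ∧ t.2.2 = c'.1 ∧
    match t.2.1 with
    | some a => ∀ i, (c'.2 i : ℤ) = (c.2 i : ℤ) + a i
    | none => c.2 0 = 0 ∧ c'.2 = c.2

/-- `Run V c π c'` : there is a run from `c` to `c'` taking the steps of the
    word of transitions `π` in order. -/
inductive Run [NeZero d] (V : TVASS d Q) :
    Config d Q → List (Trans d Q) → Config d Q → Prop
  | nil (c : Config d Q) : Run V c [] c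
  | cons {t : Trans d Q} {c c' c'' : Config d Q} {π : List (Trans d Q)} :
      t ∈ V.trans → StepBy t c c' → Run V c' π c'' → Run V c (t :: π) c''

/-- One step of the TVASS. -/
def Step [NeZero d] (V : TVASS d Q) (c c' : Config d Q) : Prop :=
  ∃ t ∈ V.trans, StepBy t c c'

/-- Reachability `c →* c'`. -/
def Reach [NeZero d] (V : TVASS d Q) (c c' : Config d Q) : Prop :=
  ∃ π, Run V c π c'

/-- `IsPathFrom V p π q` : `π` is a path (word of transitions of `V` with
    matching endpoints) from state `p` to state `q`. -/
inductive IsPathFrom (V : TVASS d Q) : Q → List (Trans d Q) → Q → Prop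
  | nil (p : Q) : IsPathFrom V p [] p
  | cons {t : Trans d Q} {π : List (Trans d Q)} {q : Q} :
      t ∈ V.trans → IsPathFrom V t.2.2 π q → IsPathFrom V t.1 (t :: π) q

/-- `n`-fold concatenation of a word. -/
def pw {α : Type*} (l : List α) (n : ℕ) : List α := (List.replicate n l).flatten

/-- A linear path scheme `α₀ β₁* α₁ ⋯ β_k* α_k`, given by the head path `α₀`
    and the list of pairs `(β₁, α₁), …, (β_k, α_k)`. -/
structure LPS (d : ℕ) (Q : Type) where
  head : List (Trans d Q)
  rest : List (List (Trans d Q) × List (Trans d Q))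

/-- Length `|L|` of a linear path scheme. -/
def LPS.len (L : LPS d Q) : ℕ :=
  L.head.length + (L.rest.map fun p => p.1.length + p.2.length).sum

/-- Number of stars `|L|_*` of a linear path scheme. -/
def LPS.stars (L : LPS d Q) : ℕ := L.rest.length

def wordRest : List (List (Trans d Q) × List (Trans d Q)) → List ℕ → List (Trans d Q)
  | [], _ => []
  | p :: rest, ns => pw p.1 (ns.headD 0) ++ p.2 ++ wordRest rest ns.tail

/-- The word `α₀ β₁^{n₁} α₁ ⋯ β_k^{n_k} α_k` of `L` for exponents `ns`. -/
def LPS.word (L : LPS d Q) (ns : List ℕ) : List (Trans d Q) :=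
  L.head ++ wordRest L.rest ns

/-- Well-formedness of the tail of a linear path scheme starting in state `s`:
    the `βᵢ` are cycles and the `αᵢ` are paths, with matching endpoints. -/
inductive ChainLPS (V : TVASS d Q) :
    Q → List (List (Trans d Q) × List (Trans d Q)) → Q → Prop
  | nil (q : Q) : ChainLPS V q [] q
  | cons {s s' q : Q} {β α : List (Trans d Q)}
      {rest : List (List (Trans d Q) × List (Trans d Q))} :
      IsPathFrom V s β s → IsPathFrom V s α s' → ChainLPS V s' rest q →
      ChainLPS V s ((β, α) :: rest) q

/-- `L` is a genuine linear path scheme from `p` to `q` in `V`. -/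
def IsLPS (V : TVASS d Q) (p : Q) (L : LPS d Q) (q : Q) : Prop :=
  ∃ s, IsPathFrom V p L.head s ∧ ChainLPS V s L.rest q

/-- `c →^L c'` : reachability along the linear path scheme `L`. -/
def ReachLPS [NeZero d] (V : TVASS d Q) (L : LPS d Q) (c c' : Config d Q) : Prop :=
  ∃ ns, Run V c (L.word ns) c'

/-- `‖x⃗‖`: maximum component of a vector of naturals. -/
def vnorm {d : ℕ} (v : Fin d → ℕ) : ℕ := Finset.univ.sup v

/-- Maximum absolute value of a component of an integer vector. -/
def vnormZ {d : ℕ} (v : Fin d → ℤ) : ℕ := Finset.univ.sup fun i => (v i).natAbs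

/-- `‖Σ‖`: maximum absolute value of a component of a vector in `Σ ∖ {tst}`
    (0 if `Σ ⊆ {tst}`). -/
def TVASS.actNorm (V : TVASS d Q) : ℕ :=
  V.acts.sup fun a => a.elim 0 vnormZ

/-- Displacement of a word of transitions (zero-tests contribute `0`). -/
def disp (π : List (Trans d Q)) : Fin d → ℤ :=
  fun i => (π.map fun t => (t.2.1.elim 0 id : Fin d → ℤ) i).sum

/-- `m_π(i)`: max over prefixes `α` of `π` (including the empty prefix) of `-Δ(α)(i)`. -/
def mpre (π : List (Trans d Q)) (i : Fin d) : ℤ :=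
  (π.inits.map fun α => -(disp α i)).foldr max 0

/-- `m_π̄(i)`: max over suffixes `σ` of `π` (including the empty suffix) of `Δ(σ)(i)`. -/
def msuf (π : List (Trans d Q)) (i : Fin d) : ℤ :=
  (π.tails.map fun σ => disp σ i).foldr max 0

/-- `π` contains no zero-test transition. -/
def noTst (π : List (Trans d Q)) : Prop := ∀ t ∈ π, t.2.1 ≠ none

/-- `x⃗ ≥₁ m⃗` : `x⃗(1) = m⃗(1)` and `x⃗(i) ≥ m⃗(i)` for all other `i`. -/
def ge1 [NeZero d] (x : Fin d → ℕ) (m : Fin d → ℤ) : Prop :=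
  (x 0 : ℤ) = m 0 ∧ ∀ i : Fin d, i ≠ 0 → m i ≤ (x i : ℤ)

/-- A path from `p` to `q` is feasible if some run takes it. -/
def Feasible [NeZero d] (V : TVASS d Q) (p : Q) (π : List (Trans d Q)) (q : Q) : Prop :=
  ∃ x y, Run V (p, x) π (q, y)

/-- `c →^{A* ∪ T} c'` : there is a run from `c` to `c'` whose path either
    contains no zero-test transition, or is a single zero-test transition. -/
def ReachAT [NeZero d] (V : TVASS d Q) (c c' : Config d Q) : Prop :=
  ∃ π, Run V c π c' ∧ (noTst π ∨ ∃ t : Trans d Q, π = [t] ∧ t.2.1 = none)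

/-- `p ⇝ q` for a 2-TVASS: `p(0, x) →* q(0, y)` for some `x, y ∈ ℕ`. -/
def Leads (V : TVASS 2 Q) (p q : Q) : Prop :=
  ∃ x y : ℕ, Reach V (p, ![0, x]) (q, ![0, y])

/-- The linear path scheme `L` is bounded from the configuration `c`: the set of
    configurations reachable from `c` along a prefix of a path in `L` is finite. -/
def BoundedLPS [NeZero d] (V : TVASS d Q) (L : LPS d Q) (c : Config d Q) : Prop :=
  {c' : Config d Q | ∃ ns ρ, ρ <+: L.word ns ∧ Run V c ρ c'}.Finite


theorem disp_append (π ρ : List (Trans d Q)) (i : Fin d) :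
    disp (π ++ ρ) i = disp π i + disp ρ i := by
  simp [disp]

theorem disp_pw (π : List (Trans d Q)) (n : ℕ) (i : Fin d) :
    disp (pw π n) i = n * disp π i := by
  induction n with
  | zero => simp [pw, disp]
  | succ n ih =>
    have : pw π (n + 1) = π ++ pw π n := by simp [pw, List.replicate_succ]
    rw [this, disp_append, ih]
    push_cast
    ring

theorem TVASS.le_actNorm {V : TVASS d Q} {p q : Q} {a : Fin d → ℤ} (h : (p, some a, q) ∈ V.trans)
    (i : Fin d) : a i ≤ V.actNorm := by
  have h₁ : vnormZ a ≤ V.actNorm :=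
    Finset.le_sup (f := fun a : Act d => a.elim 0 vnormZ) (V.mem_acts _ h)
  have h₂ : (a i).natAbs ≤ vnormZ a :=
    Finset.le_sup (f := fun i => (a i).natAbs) (Finset.mem_univ i)
  omega

section

variable [NeZero d] {V : TVASS d Q}

theorem Run.append {c c' c'' : Config d Q} {π ρ : List (Trans d Q)}
    (h : Run V c π c') (h' : Run V c' ρ c'') : Run V c (π ++ ρ) c'' := by
  induction h with
  | nil => exact h'
  | cons ht hs _ ih => exact .cons ht hs (ih h')

theorem Run.of_append {c c'' : Config d Q} {π ρ : List (Trans d Q)}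
    (h : Run V c (π ++ ρ) c'') : ∃ c', Run V c π c' ∧ Run V c' ρ c'' := by
  induction π generalizing c with
  | nil => exact ⟨c, .nil c, h⟩
  | cons t π ih =>
    cases h with
    | cons ht hs hr =>
      obtain ⟨e, h₁, h₂⟩ := ih hr
      exact ⟨e, .cons ht hs h₁, h₂⟩

theorem Run.eq_add_disp {c c' : Config d Q} {π : List (Trans d Q)} (h : Run V c π c')
    (i : Fin d) : (c'.2 i : ℤ) = c.2 i + disp π i := by
  induction h with
  | nil => simp [disp]
  | @cons t c c' c'' π ht hs _ ih =>
    obtain ⟨p, _ | a, q⟩ := t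
    · have h₂ := hs.2.2.2
      simp [disp] at ih ⊢
      rw [ih, h₂]
    · have h₂ : (c'.2 i : ℤ) = c.2 i + a i := hs.2.2 i
      simp [disp] at ih ⊢
      rw [ih, h₂]
      ring

theorem Run.disp_le {c c' : Config d Q} {π : List (Trans d Q)} (h : Run V c π c')
    (i : Fin d) : disp π i ≤ π.length * V.actNorm := by
  induction h with
  | nil => simp [disp]
  | @cons t c c' c'' π ht hs _ ih =>
    obtain ⟨p, _ | a, q⟩ := t
    · simp [disp] at ih ⊢
      nlinarith
    · have := TVASS.le_actNorm ht i
      simp [disp] at ih ⊢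
      linarith

theorem Run.le_add {c c' : Config d Q} {π : List (Trans d Q)} (h : Run V c π c') {N : ℕ}
    (hN : ∀ i, c.2 i ≤ N) (i : Fin d) : c'.2 i ≤ N + π.length * V.actNorm := by
  have h₁ := h.eq_add_disp i
  have h₂ := h.disp_le i
  have h₃ := hN i
  zify at h₃ ⊢
  linarith

/-- Runs can be shifted upwards, provided the tested counter is untouched or untested. -/
theorem Run.shift {c c' : Config d Q} {π : List (Trans d Q)} (h : Run V c π c')
    (w : Fin d → ℕ) (hw : noTst π ∨ w 0 = 0) :
    Run V (c.1, c.2 + w) π (c'.1, c'.2 + w) := by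
  induction h with
  | nil => exact .nil _
  | @cons t c c' c'' π ht hs _ ih =>
    refine .cons ht ?_ (ih (hw.imp_left fun h u hu => h u (List.mem_cons_of_mem _ hu)))
    obtain ⟨p, _ | a, q⟩ := t
    · obtain ⟨h₁, h₂, h₃, h₄⟩ := hs
      have : w 0 = 0 := hw.resolve_left fun h => h _ List.mem_cons_self rfl
      exact ⟨h₁, h₂, by simp [h₃, this], by simp [h₄]⟩
    · obtain ⟨h₁, h₂, h₃⟩ := hs
      refine ⟨h₁, h₂, fun i => ?_⟩
      have := h₃ i
      simp only [Pi.add_apply]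
      push_cast
      linarith

/-- A zero test in a word fixes the initial value of the tested counter. -/
theorem Run.noTst_or_eq {c c' e e' : Config d Q} {π : List (Trans d Q)}
    (h : Run V c π c') (h' : Run V e π e') : noTst π ∨ c.2 0 = e.2 0 := by
  induction h generalizing e with
  | nil => exact .inl (by simp [noTst])
  | @cons t c c' c'' π ht hs _ ih =>
    cases h' with
    | @cons _ _ e₁ _ _ _ hs' hr' =>
      obtain ⟨p, _ | a, q⟩ := t
      · have h₁ := hs.2.2.1
        have h₂ := hs'.2.2.1
        exact .inr (h₁.trans h₂.symm)
      · have h₁ : (c'.2 0 : ℤ) = c.2 0 + a 0 := hs.2.2 0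
        have h₂ : (e₁.2 0 : ℤ) = e.2 0 + a 0 := hs'.2.2 0
        refine (ih hr').imp (fun h u hu => ?_) fun h => by omega
        rcases List.mem_cons.1 hu with rfl | hu
        · simp
        · exact h u hu

theorem Run.source_eq {c c' e e' : Config d Q} {π : List (Trans d Q)} (hπ : π ≠ [])
    (h : Run V c π c') (h' : Run V e π e') : c.1 = e.1 := by
  cases h with
  | nil => exact absurd rfl hπ
  | cons _ hs _ =>
    cases h' with
    | cons _ hs' _ => exact hs.1.symm.trans hs'.1

/-- A repeatable word with a nonnegative nonzero effect can be iterated to reach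
    infinitely many configurations. -/
theorem infinite_of_run_run {c c₁ c₂ : Config d Q} {β : List (Trans d Q)}
    (h₁ : Run V c β c₁) (h₂ : Run V c₁ β c₂) (hpos : ∀ i, 0 ≤ disp β i)
    (hne : ∃ i, disp β i ≠ 0) : {c' | ∃ m, Run V c (pw β m) c'}.Infinite := by
  obtain ⟨j, hj⟩ := hne
  have hβ : β ≠ [] := by
    rintro rfl
    simp [disp] at hj
  have hs : c.1 = c₁.1 := Run.source_eq hβ h₁ h₂
  set w : Fin d → ℕ := fun i => (disp β i).toNat with hw
  have hc₁ : c₁.2 = c.2 + w := by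
    ext i
    have := h₁.eq_add_disp i
    have := hpos i
    simp only [Pi.add_apply, hw]
    omega
  have hw₀ : noTst β ∨ w 0 = 0 := by
    refine (h₁.noTst_or_eq h₂).imp_right fun h => ?_
    have := congrFun hc₁ 0
    simp only [Pi.add_apply] at this
    omega
  have hrun : ∀ m, Run V c (pw β m) (c.1, c.2 + m • w) := by
    intro m
    induction m with
    | zero => simpa [pw] using Run.nil c
    | succ m ih =>
      have hpw : pw β (m + 1) = pw β m ++ β := by
        simp [pw, List.replicate_succ']
      rw [hpw]
      refine ih.append ?_
      have := h₁.shift (m • w) (hw₀.imp_right fun h => by simp [h])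
      rw [hc₁, ← hs, add_assoc, add_comm w, ← succ_nsmul] at this
      exact this
  refine Set.infinite_of_injective_forall_mem (f := fun m : ℕ => (c.1, c.2 + m • w)) ?_
    fun m => ⟨m, hrun m⟩
  intro m n hmn
  have h := congrFun (Prod.ext_iff.1 hmn).2 j
  have hwj : 0 < w j := by
    have := hpos j
    simp only [hw]
    omega
  simpa [hwj.ne'] using h

theorem Run.pw_le {c c' : Config d Q} {β : List (Trans d Q)} {n N : ℕ}
    (h : Run V c (pw β n) c') (hfin : {c' | ∃ m, Run V c (pw β m) c'}.Finite)
    (hN : ∀ i, c.2 i ≤ N) (i : Fin d) :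
    c'.2 i ≤ N * (1 + β.length * V.actNorm) + β.length * V.actNorm := by
  rcases n with _ | n
  · cases h
    have := hN i
    nlinarith [Nat.zero_le (N * (β.length * V.actNorm))]
  have hsucc : pw β (n + 1) = β ++ pw β n := by simp [pw, List.replicate_succ]
  have hdisp : ∀ i, (c'.2 i : ℤ) = c.2 i + (n + 1 : ℕ) * disp β i := fun i => by
    rw [h.eq_add_disp, disp_pw]
  obtain ⟨c₁, h₁, h₂⟩ := Run.of_append (hsucc ▸ h)
  have hb := h₁.disp_le i
  have hd := hdisp i
  have hi := hN i
  by_cases hneg : ∃ j, disp β j < 0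
  · obtain ⟨j, hj⟩ := hneg
    have hnj : n + 1 ≤ N := by
      have := hdisp j
      have := hN j
      zify at *
      nlinarith
    zify at *
    have hbn : (0 : ℤ) ≤ β.length * V.actNorm := by positivity
    nlinarith [mul_le_mul_of_nonneg_left hb (by positivity : (0 : ℤ) ≤ n + 1),
      mul_le_mul_of_nonneg_right hnj hbn]
  push Not at hneg
  by_cases hzero : ∀ j, disp β j = 0
  · rw [hzero i, mul_zero, add_zero] at hd
    have : c'.2 i ≤ N := by omega
    nlinarith [Nat.zero_le (N * (β.length * V.actNorm))]
  push Not at hzero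
  rcases n with _ | n
  · have : c'.2 i ≤ N + β.length * V.actNorm := by
      zify at *
      linarith
    nlinarith [Nat.zero_le (N * (β.length * V.actNorm))]
  have hsucc' : pw β (n + 1) = β ++ pw β n := by simp [pw, List.replicate_succ]
  obtain ⟨c₂, h₃, -⟩ := Run.of_append (hsucc' ▸ h₂)
  exact absurd hfin (infinite_of_run_run h₁ h₃ hneg hzero)

theorem Run.wordRest_le {rest : List (List (Trans d Q) × List (Trans d Q))} {ns : List ℕ}
    {c c' : Config d Q} {N B : ℕ} (h : Run V c (wordRest rest ns) c')
    (hfin : {e | ∃ ns ρ, ρ <+: wordRest rest ns ∧ Run V c ρ e}.Finite)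
    (hN : ∀ i, c.2 i ≤ N)
    (hB : (rest.map fun p => p.1.length + p.2.length).sum * V.actNorm ≤ B) (i : Fin d) :
    c'.2 i ≤ (N + (rest.map fun p => p.1.length + p.2.length).sum * V.actNorm) *
      (1 + B) ^ rest.length := by
  induction rest generalizing ns c N with
  | nil =>
    cases h
    simpa using hN i
  | cons r rest ih =>
    obtain ⟨β, α⟩ := r
    simp only [wordRest] at h
    obtain ⟨c₂, h₁₂, h₃⟩ := Run.of_append h
    obtain ⟨c₁, h₁, h₂⟩ := Run.of_append h₁₂
    have hc₁ := h₁.pw_le (hfin.subset ?_) hN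
    · have hc₂ := h₂.le_add hc₁
      simp only [List.map_cons, List.sum_cons, List.length_cons] at hB ⊢
      set T := (rest.map fun p => p.1.length + p.2.length).sum
      have hfin' : {e | ∃ ns ρ, ρ <+: wordRest rest ns ∧ Run V c₂ ρ e}.Finite := by
        refine hfin.subset ?_
        rintro e ⟨ms, ρ, hρ, hr⟩
        refine ⟨ns.headD 0 :: ms, pw β (ns.headD 0) ++ α ++ ρ, ?_, h₁₂.append hr⟩
        simpa [wordRest] using hρ
      refine (ih h₃ hfin' hc₂ (le_trans (by nlinarith) hB)).trans ?_
      rw [pow_succ', ← mul_assoc]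
      refine Nat.mul_le_mul_right _ ?_
      have hb : β.length * V.actNorm ≤ B := le_trans (by nlinarith) hB
      nlinarith [Nat.mul_le_mul_left N hb,
        Nat.zero_le ((β.length + α.length + T) * V.actNorm * B)]
    · rintro e ⟨m, hr⟩
      exact ⟨[m], pw β m, by simp [wordRest], hr⟩

end

/-- Lemma: bounded linear path schemes do not blow up configurations. -/
theorem bounded_lps_norm (d : ℕ) [NeZero d] (Q : Type) [Fintype Q] [Nonempty Q]
    (V : TVASS d Q) (p q : Q) (L : LPS d Q) (hL : IsLPS V p L q)
    (x : Fin d → ℕ) (hbdd : BoundedLPS V L (p, x))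
    (y : Fin d → ℕ) (h : ReachLPS V L (p, x) (q, y)) :
    vnorm y ≤ (vnorm x + L.len * V.actNorm) * (1 + L.len * V.actNorm) ^ L.stars := by
  obtain ⟨ns, h⟩ := h
  obtain ⟨c, h₁, h₂⟩ := Run.of_append h
  have hx : ∀ i, x i ≤ vnorm x := fun i => Finset.le_sup (f := x) (Finset.mem_univ i)
  have hfin : {e | ∃ ns ρ, ρ <+: wordRest L.rest ns ∧ Run V c ρ e}.Finite := by
    refine Set.Finite.subset hbdd ?_
    rintro e ⟨ms, ρ, hρ, hr⟩
    exact ⟨ms, L.head ++ ρ, by simpa [LPS.word] using hρ, h₁.append hr⟩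
  refine Finset.sup_le fun i _ => ?_
  refine (h₂.wordRest_le hfin (h₁.le_add hx) (B := L.len * V.actNorm) ?_ i).trans_eq ?_
  · exact Nat.mul_le_mul_right _ (Nat.le_add_left _ _)
  · simp only [LPS.len, LPS.stars, add_mul, add_assoc]

end TVASSpaper
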